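/- Fix α ∈ (1,2) and N ∈ ℕ. There is a constant C = C(N, α) > 0 with the following property. For all measurable F, A : ℝ⁵ → E with ∫_{ℝ⁵}‖F‖² < ∞ and ∫_{ℝ⁵}‖A‖² < ∞ there exist functions o_F, o_A : (0,∞) → [0,∞) with o_F(r) → 0 and o_A(r) → 0 as r → 0⁺, such that: for every r > 0 and every finite family of points x_1, …, x_m in the closed ball of radius 2 centered at 0 in ℝ⁵ with the property that every point of ℝ⁵ belongs to at most N of the closed balls B̄(x_i, αr), there exist radii r_i ∈ [r, αr] (1 ≤ i ≤ m) satisfying simultaneously: (a) r·Σ_i I_{F − F̄_i}(x_i, r_i) ≤ o_F(r); (b) r·Σ_i I_{A − Ā_i}(x_i, r_i) ≤ o_A(r); and in addition, for every individual index i: (c) I_F(x_i, r_i) ≤ (C/r)·∫_{B(x_i, αr)} ‖F‖²; (d) I_A(x_i, r_i) ≤ (C/r)·∫_{B(x_i, αr)} ‖A‖²; where F̄_i := (1/|B(x_i, αr)|)∫_{B(x_i, αr)} F and Ā_i := (1/|B(x_i, αr)|)∫_{B(x_i, αr)} A. -/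

import Mathlib

open MeasureTheory Metric Set Filter

/-- A measure `σ` on the unit sphere `S⁴ ⊂ ℝ⁵` is the canonical surface measure,
normalized so that the polar-coordinates formula holds. -/
def IsPolarMeasure (σ : Measure (Metric.sphere (0 : EuclideanSpace ℝ (Fin 5)) 1)) : Prop :=
  ∀ g : EuclideanSpace ℝ (Fin 5) → ENNReal, Measurable g →
    ∀ (x : EuclideanSpace ℝ (Fin 5)) (a b : ℝ), 0 ≤ a → a ≤ b →
      (∫⁻ y in {y : EuclideanSpace ℝ (Fin 5) | dist y x ∈ Set.Icc a b}, g y) =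
        ∫⁻ ρ in Set.Icc a b,
          (∫⁻ ω, g (x + ρ • (ω : EuclideanSpace ℝ (Fin 5))) ∂σ) * ENNReal.ofReal (ρ ^ 4)

/-- The boundary energy `I_G(x, ρ) = ∫_{S⁴} ‖G(x + ρω)‖² ρ⁴ dσ(ω)` of `G` through the
sphere `∂B(x, ρ)`. -/
noncomputable def bdryEnergy {E : Type*} [NormedAddCommGroup E]
    (σ : Measure (Metric.sphere (0 : EuclideanSpace ℝ (Fin 5)) 1))
    (G : EuclideanSpace ℝ (Fin 5) → E) (x : EuclideanSpace ℝ (Fin 5)) (ρ : ℝ) : ENNReal :=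
  (∫⁻ ω, ENNReal.ofReal (‖G (x + ρ • (ω : EuclideanSpace ℝ (Fin 5)))‖ ^ 2) ∂σ) *
    ENNReal.ofReal (ρ ^ 4)

/-- The squared norm used in `bdryEnergy`, rewritten with `enorm`. -/
lemma ofReal_norm_sq_eq_enorm_sq {E : Type*} [NormedAddCommGroup E] (v : E) :
    ENNReal.ofReal (‖v‖ ^ 2) = ‖v‖ₑ ^ 2 := by
  rw [ENNReal.ofReal_pow (norm_nonneg v), ofReal_norm]

lemma enorm_add_sq_le {E : Type*} [NormedAddCommGroup E] (u v : E) :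
    ‖u + v‖ₑ ^ 2 ≤ 2 * ‖u‖ₑ ^ 2 + 2 * ‖v‖ₑ ^ 2 := by
  have h : ‖u + v‖ ^ 2 ≤ 2 * ‖u‖ ^ 2 + 2 * ‖v‖ ^ 2 :=
    (pow_le_pow_left₀ (norm_nonneg _) (norm_add_le u v) 2).trans (by
      nlinarith [sq_nonneg (‖u‖ - ‖v‖)])
  have := ENNReal.ofReal_le_ofReal h
  rwa [ENNReal.ofReal_add (by positivity) (by positivity), ENNReal.ofReal_mul (by norm_num),
    ENNReal.ofReal_mul (by norm_num), ofReal_norm_sq_eq_enorm_sq, ofReal_norm_sq_eq_enorm_sq,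
    ofReal_norm_sq_eq_enorm_sq, ENNReal.ofReal_ofNat] at this

/-- Simultaneous Markov selection: finitely many functions admit a common point of a set of
positive finite measure at which each is bounded by a multiple of its mean value. -/
lemma exists_mem_forall_le_mul_setLIntegral {X ι : Type*} [MeasurableSpace X] [Fintype ι]
    {μ : Measure X} {s : Set X} (h0 : μ s ≠ 0) (htop : μ s ≠ ⊤)
    {f : ι → X → ENNReal} (hf : ∀ k, Measurable (f k)) :
    ∃ t ∈ s, ∀ k, f k t ≤ ((Fintype.card ι + 1 : ℕ) : ENNReal) / μ s * ∫⁻ u in s, f k u ∂μ := by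
  set n := Fintype.card ι
  set K : ENNReal := ((n + 1 : ℕ) : ENNReal) / μ s with hK
  have hn0 : ((n + 1 : ℕ) : ENNReal) ≠ 0 := by exact_mod_cast n.succ_ne_zero
  have hK0 : K ≠ 0 := ENNReal.div_ne_zero.2 ⟨hn0, htop⟩
  have hKtop : K ≠ ⊤ := ENNReal.div_ne_top (ENNReal.natCast_ne_top _) h0
  by_contra! hcon
  set B : ι → Set X := fun k => {t | K * ∫⁻ u in s, f k u ∂μ < f k t}
  have hB : ∀ k, μ.restrict s (B k) ≤ K⁻¹ := by
    intro k
    by_cases hI0 : ∫⁻ u in s, f k u ∂μ = 0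
    · have hae := (lintegral_eq_zero_iff (hf k)).1 hI0
      have : μ.restrict s (B k) = 0 := by
        rw [← nonpos_iff_eq_zero, ← ae_iff.1 hae]
        refine measure_mono fun t ht => ?_
        simpa [B, hI0, pos_iff_ne_zero] using ht
      simp [this]
    by_cases hIt : ∫⁻ u in s, f k u ∂μ = ⊤
    · have : B k = ∅ := by
        ext t
        simp [B, hIt, ENNReal.mul_top hK0]
      simp [this]
    · calc μ.restrict s (B k) ≤ μ.restrict s {t | K * ∫⁻ u in s, f k u ∂μ ≤ f k t} :=
            measure_mono fun t ht => by
              simp only [B, Set.mem_ofPred_eq] at ht ⊢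
              exact ht.le
        _ ≤ (∫⁻ u in s, f k u ∂μ) / (K * ∫⁻ u in s, f k u ∂μ) :=
            meas_ge_le_lintegral_div (hf k).aemeasurable (mul_ne_zero hK0 hI0)
              (ENNReal.mul_ne_top hKtop hIt)
        _ = K⁻¹ := by
            rw [div_eq_mul_inv, ENNReal.mul_inv (Or.inl hK0) (Or.inl hKtop), mul_left_comm,
              ENNReal.mul_inv_cancel hI0 hIt, mul_one]
  have hcover : μ s ≤ n * K⁻¹ :=
    calc μ s = μ.restrict s s := by simp
      _ ≤ μ.restrict s (⋃ k, B k) := by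
          refine measure_mono fun t ht => ?_
          obtain ⟨k, hk⟩ := hcon t ht
          exact Set.mem_iUnion.2 ⟨k, hk⟩
      _ ≤ ∑ k, μ.restrict s (B k) := measure_iUnion_fintype_le _ _
      _ ≤ ∑ _k : ι, K⁻¹ := Finset.sum_le_sum fun k _ => hB k
      _ = n * K⁻¹ := by simp [n]
  have hlt : (n : ENNReal) * K⁻¹ < ((n + 1 : ℕ) : ENNReal) * K⁻¹ :=
    (ENNReal.mul_lt_mul_iff_left (ENNReal.inv_ne_zero.2 hKtop) (ENNReal.inv_ne_top.2 hK0)).2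
      (by exact_mod_cast n.lt_succ_self)
  have heq : ((n + 1 : ℕ) : ENNReal) * K⁻¹ = μ s := by
    rw [hK, ENNReal.inv_div (Or.inl htop) (Or.inl h0),
      ENNReal.mul_div_cancel hn0 (ENNReal.natCast_ne_top _)]
  exact absurd (hcover.trans_lt hlt) (by rw [heq]; exact lt_irrefl _)

/-- Integrals over a finite family of sets with bounded overlap. -/
lemma sum_setLIntegral_le_of_ncard_le {X ι : Type*} [MeasurableSpace X] [Fintype ι]
    {μ : Measure X} {s : ι → Set X} (hs : ∀ i, MeasurableSet (s i)) {N : ℕ}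
    (hN : ∀ y, {i | y ∈ s i}.ncard ≤ N) {h : X → ENNReal} (hh : Measurable h) :
    ∑ i, ∫⁻ y in s i, h y ∂μ ≤ N * ∫⁻ y, h y ∂μ := by
  classical
  simp_rw [← lintegral_indicator (hs _)]
  rw [← lintegral_finsetSum _ fun i _ => hh.indicator (hs i), ← lintegral_const_mul _ hh]
  refine lintegral_mono fun y => ?_
  simp only [Set.indicator_apply]
  rw [← Finset.sum_filter, Finset.sum_const, nsmul_eq_mul]
  gcongr
  have := hN y
  rwa [Set.ncard_eq_toFinset_card', Set.toFinset_ofPred] at this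

/-- Up to a factor, the mean value minimizes the quadratic deviation on a set. -/
lemma setLIntegral_enorm_sub_setAverage_sq_le {X E : Type*} [MeasurableSpace X]
    [NormedAddCommGroup E] [NormedSpace ℝ E] [CompleteSpace E] {μ : Measure X} {s : Set X}
    (h0 : μ s ≠ 0) (htop : μ s ≠ ⊤) {F : X → E} (hF : MemLp F 2 (μ.restrict s)) (c : E) :
    ∫⁻ y in s, ‖F y - ⨍ z in s, F z ∂μ‖ₑ ^ 2 ∂μ ≤ 4 * ∫⁻ y in s, ‖F y - c‖ₑ ^ 2 ∂μ := by
  have hfin : IsFiniteMeasure (μ.restrict s) := ⟨by simpa using htop.lt_top⟩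
  have hFc : MemLp (fun y => F y - c) 2 (μ.restrict s) := hF.sub (memLp_const c)
  have hsq : Integrable (fun y => ‖F y - c‖ ^ 2) (μ.restrict s) :=
    (memLp_two_iff_integrable_sq_norm hFc.1).1 hFc
  have hconv : ConvexOn ℝ Set.univ fun v : E => ‖v - c‖ ^ 2 := by
    refine ConvexOn.pow ?_ (fun v _ => norm_nonneg _) 2
    simpa [Function.comp_def, sub_eq_add_neg] using
      (convexOn_univ_norm (E := E)).translate_left (-c)
  have hJ := hconv.map_set_average_le (by fun_prop) isClosed_univ h0 htop (by simp)
    (hF.integrable (by norm_num)) hsq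
  have hmean : μ s * ‖c - ⨍ z in s, F z ∂μ‖ₑ ^ 2 ≤ ∫⁻ y in s, ‖F y - c‖ₑ ^ 2 ∂μ := by
    simp_rw [← ofReal_norm_sq_eq_enorm_sq]
    rw [← ofReal_integral_eq_lintegral_ofReal hsq (ae_of_all _ fun y => by positivity),
      ← ENNReal.ofReal_toReal htop, ← ENNReal.ofReal_mul ENNReal.toReal_nonneg]
    refine ENNReal.ofReal_le_ofReal ?_
    rw [setAverage_eq μ (fun y => ‖F y - c‖ ^ 2), smul_eq_mul] at hJ
    have hpos : 0 < (μ s).toReal := ENNReal.toReal_pos h0 htop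
    rw [norm_sub_rev]
    have := mul_le_mul_of_nonneg_left hJ hpos.le
    rwa [measureReal_def, mul_inv_cancel_left₀ hpos.ne'] at this
  calc ∫⁻ y in s, ‖F y - ⨍ z in s, F z ∂μ‖ₑ ^ 2 ∂μ
      ≤ ∫⁻ y in s, (2 * ‖F y - c‖ₑ ^ 2 + 2 * ‖c - ⨍ z in s, F z ∂μ‖ₑ ^ 2) ∂μ := by
        refine lintegral_mono fun y => ?_
        simpa using enorm_add_sq_le (F y - c) (c - ⨍ z in s, F z ∂μ)
    _ = 2 * ∫⁻ y in s, ‖F y - c‖ₑ ^ 2 ∂μ + 2 * (μ s * ‖c - ⨍ z in s, F z ∂μ‖ₑ ^ 2) := by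
        rw [lintegral_add_right _ measurable_const, lintegral_const_mul' _ _ (by norm_num),
          lintegral_const, Measure.restrict_apply_univ]
        ring
    _ ≤ 2 * ∫⁻ y in s, ‖F y - c‖ₑ ^ 2 ∂μ + 2 * ∫⁻ y in s, ‖F y - c‖ₑ ^ 2 ∂μ := by gcongr
    _ = 4 * ∫⁻ y in s, ‖F y - c‖ₑ ^ 2 ∂μ := by ring

/-- The largest total quadratic oscillation of `F` over the balls `B(x i, R)`, among finite families
of centres in the closed ball of radius `2` for which the closed balls have overlap at most `N`. -/
noncomputable def supOscillation {E : Type*} [NormedAddCommGroup E] [NormedSpace ℝ E] (N : ℕ)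
    (F : EuclideanSpace ℝ (Fin 5) → E) (R : ℝ) : ENNReal :=
  ⨆ (m : ℕ) (x : Fin m → EuclideanSpace ℝ (Fin 5))
    (_ : ∀ i, x i ∈ Metric.closedBall (0 : EuclideanSpace ℝ (Fin 5)) 2)
    (_ : ∀ y, {i : Fin m | y ∈ Metric.closedBall (x i) R}.ncard ≤ N),
    ∑ i, ∫⁻ y in Metric.ball (x i) R, ‖F y - ⨍ z in Metric.ball (x i) R, F z‖ₑ ^ 2

lemma ncard_mem_ball_le {X ι : Type*} [PseudoMetricSpace X] [Finite ι] {x : ι → X} {R : ℝ} {N : ℕ}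
    (h : ∀ y, {i | y ∈ Metric.closedBall (x i) R}.ncard ≤ N) (y : X) :
    {i | y ∈ Metric.ball (x i) R}.ncard ≤ N := by
  refine le_trans (Set.ncard_le_ncard ?_ (Set.toFinite _)) (h y)
  intro i hi
  simp only [Set.mem_ofPred_eq] at hi ⊢
  exact Metric.ball_subset_closedBall hi

section Oscillation

variable {E : Type*} [NormedAddCommGroup E] [NormedSpace ℝ E] [FiniteDimensional ℝ E]
  [MeasurableSpace E] [BorelSpace E] {F : EuclideanSpace ℝ (Fin 5) → E}

lemma supOscillation_le (hF : Measurable F) (hF2 : MemLp F 2) (N : ℕ) {R : ℝ} (hR : 0 < R) :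
    supOscillation N F R ≤ 4 * (N * ∫⁻ y, ‖F y‖ₑ ^ 2) := by
  have : CompleteSpace E := FiniteDimensional.complete ℝ E
  refine iSup_le fun m => iSup_le fun x => iSup_le fun _ => iSup_le fun hN => ?_
  calc ∑ i, ∫⁻ y in Metric.ball (x i) R, ‖F y - ⨍ z in Metric.ball (x i) R, F z‖ₑ ^ 2
      ≤ ∑ i, 4 * ∫⁻ y in Metric.ball (x i) R, ‖F y‖ₑ ^ 2 := by
        refine Finset.sum_le_sum fun i _ => ?_
        simpa using setLIntegral_enorm_sub_setAverage_sq_le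
          (Metric.measure_ball_pos volume (x i) hR).ne' measure_ball_lt_top.ne (hF2.restrict _) 0
    _ = 4 * ∑ i, ∫⁻ y in Metric.ball (x i) R, ‖F y‖ₑ ^ 2 := by rw [Finset.mul_sum]
    _ ≤ _ := by
        gcongr
        exact sum_setLIntegral_le_of_ncard_le (fun i => measurableSet_ball) (ncard_mem_ball_le hN)
          (hF.enorm.pow_const 2)

lemma tendsto_supOscillation (hF : Measurable F) (hF2 : MemLp F 2) (N : ℕ) :
    Tendsto (supOscillation N F) (nhdsWithin 0 (Set.Ioi 0)) (nhds 0) := by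
  have : CompleteSpace E := FiniteDimensional.complete ℝ E
  rw [ENNReal.tendsto_nhds_zero]
  intro ε hε
  set V : ENNReal := volume (Metric.closedBall (0 : EuclideanSpace ℝ (Fin 5)) 3) with hV
  have hVtop : V ≠ ⊤ := measure_closedBall_lt_top.ne
  obtain ⟨δ, hδ, hδε⟩ := ENNReal.exists_nnreal_pos_mul_lt
    (a := 8 * (N * (1 + V))) (b := ε)
    (by finiteness) hε.ne'
  obtain ⟨η, hη, hηδ⟩ : ∃ η : NNReal, 0 < η ∧ η ^ 2 ≤ δ :=
    ⟨NNReal.sqrt δ, NNReal.sqrt_pos.2 hδ, by simp⟩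
  obtain ⟨g, hgc, hFg, hg, hg2⟩ := hF2.exists_hasCompactSupport_eLpNorm_sub_le (by norm_num)
    (ε := (η : ENNReal)) (by exact_mod_cast hη.ne')
  have hFg2 : ∫⁻ y, ‖F y - g y‖ₑ ^ 2 ≤ δ := by
    have h := eLpNorm_nnreal_pow_eq_lintegral (f := F - g) (μ := volume) (p := 2) (by norm_num)
    norm_num at h
    rw [← h]
    calc _ ≤ (η : ENNReal) ^ 2 := by gcongr
      _ ≤ δ := by exact_mod_cast hηδ
  obtain ⟨d, hd, hgd⟩ := Metric.uniformContinuous_iff.1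
    (hgc.uniformContinuous_of_continuous hg) η hη
  have hmem : Set.Ioo (0 : ℝ) (min d 1) ∈ nhdsWithin (0 : ℝ) (Set.Ioi 0) :=
    Ioo_mem_nhdsGT (by positivity)
  filter_upwards [hmem] with R hR
  have hRd : R < d := hR.2.trans_le (min_le_left _ _)
  have hR1 : R < 1 := hR.2.trans_le (min_le_right _ _)
  refine (iSup_le fun m => iSup_le fun x => iSup_le fun hx => iSup_le fun hN => ?_).trans hδε.le
  have hmeas : Measurable fun y => ‖F y - g y‖ₑ ^ 2 := (hF.sub hg.measurable).enorm.pow_const 2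
  have hball : ∀ i, ∫⁻ y in Metric.ball (x i) R, ‖F y - ⨍ z in Metric.ball (x i) R, F z‖ₑ ^ 2 ≤
      8 * ∫⁻ y in Metric.ball (x i) R, (‖F y - g y‖ₑ ^ 2 +
        (Metric.closedBall (0 : EuclideanSpace ℝ (Fin 5)) 3).indicator (fun _ => (δ : ENNReal)) y) := by
    intro i
    calc _ ≤ 4 * ∫⁻ y in Metric.ball (x i) R, ‖F y - g (x i)‖ₑ ^ 2 :=
          setLIntegral_enorm_sub_setAverage_sq_le
            (Metric.measure_ball_pos volume (x i) hR.1).ne' measure_ball_lt_top.ne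
            (hF2.restrict _) _
      _ ≤ 4 * ∫⁻ y in Metric.ball (x i) R, 2 * (‖F y - g y‖ₑ ^ 2 +
        (Metric.closedBall (0 : EuclideanSpace ℝ (Fin 5)) 3).indicator
          (fun _ => (δ : ENNReal)) y) := by
          gcongr 4 * ?_
          refine setLIntegral_mono' measurableSet_ball fun y hy => ?_
          have hy3 : y ∈ Metric.closedBall (0 : EuclideanSpace ℝ (Fin 5)) 3 := by
            have h1 := Metric.mem_closedBall.1 (hx i)
            have h2 := Metric.mem_ball.1 hy
            have h3 := dist_triangle y (x i) 0
            exact Metric.mem_closedBall.2 (by linarith)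
          have hgy : ‖g y - g (x i)‖ₑ ^ 2 ≤ δ := by
            have h := (hgd ((Metric.mem_ball.1 hy).trans hRd)).le
            rw [dist_eq_norm] at h
            have h' : ‖g y - g (x i)‖ₑ ≤ η := by
              rw [enorm_le_coe]
              exact_mod_cast h
            calc _ ≤ (η : ENNReal) ^ 2 := by gcongr
              _ ≤ δ := by exact_mod_cast hηδ
          rw [Set.indicator_of_mem hy3]
          calc ‖F y - g (x i)‖ₑ ^ 2 ≤ 2 * ‖F y - g y‖ₑ ^ 2 + 2 * ‖g y - g (x i)‖ₑ ^ 2 := by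
                simpa using enorm_add_sq_le (F y - g y) (g y - g (x i))
            _ ≤ 2 * (‖F y - g y‖ₑ ^ 2 + δ) := by rw [mul_add]; gcongr
      _ = _ := by
          rw [lintegral_const_mul' _ _ (by norm_num), ← mul_assoc]
          norm_num
  calc _ ≤ ∑ i, 8 * ∫⁻ y in Metric.ball (x i) R, (‖F y - g y‖ₑ ^ 2 +
        (Metric.closedBall (0 : EuclideanSpace ℝ (Fin 5)) 3).indicator (fun _ => (δ : ENNReal)) y) :=
        Finset.sum_le_sum fun i _ => hball i
    _ ≤ 8 * (N * ∫⁻ y, (‖F y - g y‖ₑ ^ 2 +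
        (Metric.closedBall (0 : EuclideanSpace ℝ (Fin 5)) 3).indicator
          (fun _ => (δ : ENNReal)) y)) := by
        rw [← Finset.mul_sum]
        gcongr
        exact sum_setLIntegral_le_of_ncard_le (fun i => measurableSet_ball) (ncard_mem_ball_le hN)
          (hmeas.add (measurable_const.indicator measurableSet_closedBall))
    _ ≤ 8 * (N * (δ + δ * V)) := by
        rw [lintegral_add_left hmeas, lintegral_indicator_const measurableSet_closedBall]
        gcongr
    _ = δ * (8 * (N * (1 + V))) := by ring

end Oscillation

section Polar

variable {σ : Measure (Metric.sphere (0 : EuclideanSpace ℝ (Fin 5)) 1)}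

lemma IsPolarMeasure.isFiniteMeasure (hσ : IsPolarMeasure σ) : IsFiniteMeasure σ := by
  refine ⟨lt_top_iff_ne_top.2 fun htop => ?_⟩
  have h := hσ (fun _ => 1) measurable_const 0 1 2 zero_le_one one_le_two
  have hlt : ∫⁻ _y in {y : EuclideanSpace ℝ (Fin 5) | dist y 0 ∈ Set.Icc (1 : ℝ) 2}, (1 : ENNReal)
      < ⊤ := by
    rw [setLIntegral_one]
    exact (measure_mono fun y hy => hy.2).trans_lt
      (measure_closedBall_lt_top (x := (0 : EuclideanSpace ℝ (Fin 5))) (r := 2))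
  rw [h] at hlt
  refine hlt.ne (top_le_iff.1 ?_)
  calc (⊤ : ENNReal) = ∫⁻ _ρ in Set.Icc (1 : ℝ) 2, ⊤ := by norm_num
    _ ≤ _ := by
      refine setLIntegral_mono' measurableSet_Icc fun ρ hρ => ?_
      have hρ0 : 0 < ρ := one_pos.trans_le hρ.1
      rw [lintegral_const, htop, ENNReal.mul_top one_ne_zero,
        ENNReal.top_mul (ENNReal.ofReal_pos.2 (by positivity)).ne']

variable {E : Type*} [NormedAddCommGroup E] [MeasurableSpace E] [BorelSpace E]
  {G : EuclideanSpace ℝ (Fin 5) → E}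

lemma measurable_bdryEnergy [SFinite σ] (hG : Measurable G) (x : EuclideanSpace ℝ (Fin 5)) :
    Measurable (bdryEnergy σ G x) := by
  unfold bdryEnergy
  refine Measurable.mul (Measurable.lintegral_prod_right ?_) (by fun_prop)
  have : Measurable fun p : ℝ × Metric.sphere (0 : EuclideanSpace ℝ (Fin 5)) 1 =>
      x + p.1 • (p.2 : EuclideanSpace ℝ (Fin 5)) := by fun_prop
  exact ((hG.comp this).norm.pow_const 2).ennreal_ofReal

lemma ball_ae_eq_closedBall (x : EuclideanSpace ℝ (Fin 5)) (b : ℝ) :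
    (Metric.ball x b : Set _) =ᵐ[volume] Metric.closedBall x b := by
  refine Metric.ball_subset_closedBall.eventuallyLE.antisymm ?_
  rw [ae_le_set, Metric.closedBall_sdiff_ball]
  exact Measure.addHaar_sphere _ _ _

lemma IsPolarMeasure.setLIntegral_bdryEnergy_le (hσ : IsPolarMeasure σ) (hG : Measurable G)
    (x : EuclideanSpace ℝ (Fin 5)) {a b : ℝ} (ha : 0 ≤ a) (hab : a ≤ b) :
    ∫⁻ ρ in Set.Icc a b, bdryEnergy σ G x ρ ≤ ∫⁻ y in Metric.ball x b, ‖G y‖ₑ ^ 2 := by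
  unfold bdryEnergy
  rw [← hσ (fun y => ENNReal.ofReal (‖G y‖ ^ 2)) (hG.norm.pow_const 2).ennreal_ofReal x a b ha hab]
  simp_rw [ofReal_norm_sq_eq_enorm_sq]
  rw [setLIntegral_congr (ball_ae_eq_closedBall x b)]
  exact lintegral_mono_set fun y hy => hy.2

end Polar

/-- Proposition 4.6 of the paper: good grid radii, Morrey refinement. -/
theorem good_grid_radii_morrey {E : Type*} [NormedAddCommGroup E] [NormedSpace ℝ E]
    [FiniteDimensional ℝ E] [MeasurableSpace E] [BorelSpace E]
    (α : ℝ) (hα1 : 1 < α) (hα2 : α < 2) (N : ℕ)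
    (σ : Measure (Metric.sphere (0 : EuclideanSpace ℝ (Fin 5)) 1)) (hσ : IsPolarMeasure σ) :
    ∃ C : ℝ, 0 < C ∧
      ∀ (F A : EuclideanSpace ℝ (Fin 5) → E), Measurable F → Measurable A →
      (∫⁻ y, ENNReal.ofReal (‖F y‖ ^ 2)) < ⊤ → (∫⁻ y, ENNReal.ofReal (‖A y‖ ^ 2)) < ⊤ →
      ∃ oF oA : ℝ → ℝ,
        (∀ r, 0 ≤ oF r) ∧ (∀ r, 0 ≤ oA r) ∧
        Tendsto oF (nhdsWithin 0 (Set.Ioi 0)) (nhds 0) ∧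
        Tendsto oA (nhdsWithin 0 (Set.Ioi 0)) (nhds 0) ∧
        ∀ (r : ℝ), 0 < r → ∀ (m : ℕ) (x : Fin m → EuclideanSpace ℝ (Fin 5)),
          (∀ i, x i ∈ Metric.closedBall (0 : EuclideanSpace ℝ (Fin 5)) 2) →
          (∀ y : EuclideanSpace ℝ (Fin 5),
            ({i : Fin m | y ∈ Metric.closedBall (x i) (α * r)}).ncard ≤ N) →
          ∃ rad : Fin m → ℝ, (∀ i, rad i ∈ Set.Icc r (α * r)) ∧
            -- (a) summed oscillation bound for F
            ENNReal.ofReal r * ∑ i, bdryEnergy σ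
                (fun y => F y - ⨍ z in Metric.ball (x i) (α * r), F z) (x i) (rad i)
              ≤ ENNReal.ofReal (oF r) ∧
            -- (b) summed oscillation bound for A
            ENNReal.ofReal r * ∑ i, bdryEnergy σ
                (fun y => A y - ⨍ z in Metric.ball (x i) (α * r), A z) (x i) (rad i)
              ≤ ENNReal.ofReal (oA r) ∧
            -- (c) individual Morrey-type bound for F
            (∀ i, bdryEnergy σ F (x i) (rad i)
              ≤ ENNReal.ofReal (C / r) *
                ∫⁻ y in Metric.ball (x i) (α * r), ENNReal.ofReal (‖F y‖ ^ 2)) ∧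
            -- (d) individual Morrey-type bound for A
            (∀ i, bdryEnergy σ A (x i) (rad i)
              ≤ ENNReal.ofReal (C / r) *
                ∫⁻ y in Metric.ball (x i) (α * r), ENNReal.ofReal (‖A y‖ ^ 2)) := by
  have : IsFiniteMeasure σ := hσ.isFiniteMeasure
  have hα0 : 0 < α - 1 := by linarith
  refine ⟨5 / (α - 1), by positivity, fun F A hF hA hF2 hA2 => ?_⟩
  have hmemLp : ∀ G : EuclideanSpace ℝ (Fin 5) → E, Measurable G →
      (∫⁻ y, ENNReal.ofReal (‖G y‖ ^ 2)) < ⊤ → MemLp G 2 := fun G hG hG2 =>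
    (memLp_two_iff_integrable_sq_norm hG.aestronglyMeasurable).2
      ⟨(hG.norm.pow_const 2).aestronglyMeasurable, by
        rwa [hasFiniteIntegral_iff_ofReal (ae_of_all _ fun y => by positivity)]⟩
  set K : ENNReal := ENNReal.ofReal (5 / (α - 1)) with hK
  have hfin : ∀ G : EuclideanSpace ℝ (Fin 5) → E, Measurable G →
      (∫⁻ y, ENNReal.ofReal (‖G y‖ ^ 2)) < ⊤ → ∀ r : ℝ, 0 < r →
      K * supOscillation N G (α * r) ≠ ⊤ := fun G hG hG2 r hr => by
    have h := supOscillation_le hG (hmemLp G hG hG2) N (R := α * r) (by positivity)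
    simp_rw [ofReal_norm_sq_eq_enorm_sq] at hG2
    have h4 : supOscillation N G (α * r) ≠ ⊤ := (h.trans_lt (by finiteness)).ne
    finiteness
  have htend : ∀ G : EuclideanSpace ℝ (Fin 5) → E, Measurable G →
      (∫⁻ y, ENNReal.ofReal (‖G y‖ ^ 2)) < ⊤ →
      Tendsto (fun r => (K * supOscillation N G (α * r)).toReal)
        (nhdsWithin 0 (Set.Ioi 0)) (nhds 0) := fun G hG hG2 => by
    have hscale : Tendsto (fun r : ℝ => α * r) (nhdsWithin 0 (Set.Ioi 0))
        (nhdsWithin 0 (Set.Ioi 0)) := by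
      refine tendsto_nhdsWithin_iff.2 ⟨?_, ?_⟩
      · exact Tendsto.mono_left
          (by simpa using (continuous_const_mul α).tendsto (0 : ℝ)) nhdsWithin_le_nhds
      · filter_upwards [self_mem_nhdsWithin] with r hr
        have : 0 < r := hr
        exact Set.mem_Ioi.2 (by positivity)
    have h := ENNReal.Tendsto.const_mul (a := K)
      ((tendsto_supOscillation hG (hmemLp G hG hG2) N).comp hscale)
      (Or.inr ENNReal.ofReal_ne_top)
    rw [mul_zero] at h
    simpa [Function.comp_def] using (ENNReal.tendsto_toReal ENNReal.zero_ne_top).comp h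
  refine ⟨fun r => (K * supOscillation N F (α * r)).toReal,
    fun r => (K * supOscillation N A (α * r)).toReal, fun _ => ENNReal.toReal_nonneg,
    fun _ => ENNReal.toReal_nonneg, htend F hF hF2, htend A hA hA2, fun r hr m x hx hN => ?_⟩
  have hle : r ≤ α * r := by nlinarith
  let G : Fin m → Fin 4 → EuclideanSpace ℝ (Fin 5) → E := fun i =>
    ![fun y => F y - ⨍ z in Metric.ball (x i) (α * r), F z,
      fun y => A y - ⨍ z in Metric.ball (x i) (α * r), A z, F, A]
  have hG : ∀ i k, Measurable (G i k) := by
    intro i k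
    fin_cases k
    exacts [hF.sub_const _, hA.sub_const _, hF, hA]
  have hvol : volume (Set.Icc r (α * r)) = ENNReal.ofReal ((α - 1) * r) := by
    rw [Real.volume_Icc]; ring_nf
  have hmean : ((Fintype.card (Fin 4) + 1 : ℕ) : ENNReal) / volume (Set.Icc r (α * r)) =
      ENNReal.ofReal (5 / (α - 1) / r) := by
    rw [hvol, div_div, ENNReal.ofReal_div_of_pos (by positivity)]
    norm_num
  have hrad : ∀ i, ∃ ρ ∈ Set.Icc r (α * r), ∀ k, bdryEnergy σ (G i k) (x i) ρ ≤
      ENNReal.ofReal (5 / (α - 1) / r) *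
        ∫⁻ y in Metric.ball (x i) (α * r), ‖G i k y‖ₑ ^ 2 := by
    intro i
    obtain ⟨ρ, hρ, h⟩ := exists_mem_forall_le_mul_setLIntegral (μ := volume)
      (s := Set.Icc r (α * r))
      (by rw [hvol]; exact (ENNReal.ofReal_pos.2 (by positivity)).ne')
      (by rw [hvol]; exact ENNReal.ofReal_ne_top)
      (f := fun k => bdryEnergy σ (G i k) (x i)) (fun k => measurable_bdryEnergy (hG i k) (x i))
    refine ⟨ρ, hρ, fun k => (h k).trans ?_⟩
    rw [hmean]
    gcongr
    exact hσ.setLIntegral_bdryEnergy_le (hG i k) (x i) hr.le hle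
  choose rad hrad hbound using hrad
  have hsum : ∀ H : EuclideanSpace ℝ (Fin 5) → E, Measurable H →
      (∫⁻ y, ENNReal.ofReal (‖H y‖ ^ 2)) < ⊤ →
      (∀ i, bdryEnergy σ (fun y => H y - ⨍ z in Metric.ball (x i) (α * r), H z) (x i) (rad i) ≤
        ENNReal.ofReal (5 / (α - 1) / r) * ∫⁻ y in Metric.ball (x i) (α * r),
          ‖H y - ⨍ z in Metric.ball (x i) (α * r), H z‖ₑ ^ 2) →
      ENNReal.ofReal r * ∑ i, bdryEnergy σ
        (fun y => H y - ⨍ z in Metric.ball (x i) (α * r), H z) (x i) (rad i) ≤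
      ENNReal.ofReal (K * supOscillation N H (α * r)).toReal := by
    intro H hH hH2 hb
    rw [ENNReal.ofReal_toReal (hfin H hH hH2 r hr)]
    calc _ ≤ ENNReal.ofReal r * ∑ i, ENNReal.ofReal (5 / (α - 1) / r) *
            ∫⁻ y in Metric.ball (x i) (α * r),
              ‖H y - ⨍ z in Metric.ball (x i) (α * r), H z‖ₑ ^ 2 := by
          gcongr with i
          exact hb i
      _ = K * ∑ i, ∫⁻ y in Metric.ball (x i) (α * r),
              ‖H y - ⨍ z in Metric.ball (x i) (α * r), H z‖ₑ ^ 2 := by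
          rw [← Finset.mul_sum, ← mul_assoc, ← ENNReal.ofReal_mul hr.le,
            mul_div_cancel₀ _ hr.ne']
      _ ≤ _ := by
          gcongr
          exact le_iSup_of_le m (le_iSup_of_le x (le_iSup_of_le hx (le_iSup_of_le hN le_rfl)))
  simp_rw [ofReal_norm_sq_eq_enorm_sq] at hsum ⊢
  simp_rw [ofReal_norm_sq_eq_enorm_sq] at hF2 hA2
  exact ⟨rad, hrad, hsum F hF hF2 fun i => hbound i 0, hsum A hA hA2 fun i => hbound i 1,
    fun i => hbound i 2, fun i => hbound i 3⟩
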